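/- arXiv:1404.3145 — 4 statements merged into one kernel-verified Lean document; each statement's English description precedes it below -/
import Mathlib

section
/- Every P_i^(l) produced by the gSPAWN covariance recursion is positive definite: for all i ∈ {1,…,n} and all l ≥ 0, P_i^(l) ≻ 0. -/
open Matrix
open scoped ComplexOrder

/-- If `∑ j ∈ s, (G j)ᴴ * G j` is positive definite, it stays so after inserting positive definite
weights. -/
theorem Matrix.PosDef.sum_conjTranspose_mul_mul {𝕜 ι m d : Type*} [RCLike 𝕜] [Fintype m]
    [Fintype d] {s : Finset ι} {G : ι → Matrix m d 𝕜} {W : ι → Matrix m m 𝕜}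
    (hG : (∑ j ∈ s, (G j)ᴴ * G j).PosDef) (hW : ∀ j ∈ s, (W j).PosDef) :
    (∑ j ∈ s, (G j)ᴴ * W j * G j).PosDef := by
  have hterm : ∀ j ∈ s, ((G j)ᴴ * W j * G j).PosSemidef := fun j hj =>
    (hW j hj).posSemidef.conjTranspose_mul_mul_same (G j)
  refine .of_dotProduct_mulVec_pos (posSemidef_sum s hterm).isHermitian fun x hx => ?_
  obtain ⟨j, hj, hjx⟩ : ∃ j ∈ s, G j *ᵥ x ≠ 0 := by
    by_contra! hker
    have hpos := hG.dotProduct_mulVec_pos hx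
    rw [sum_mulVec, Finset.sum_congr rfl fun j hj => by
      rw [← mulVec_mulVec, hker j hj, mulVec_zero]] at hpos
    simp at hpos
  rw [sum_mulVec, dotProduct_sum]
  refine Finset.sum_pos' (fun k hk => (hterm k hk).dotProduct_mulVec_nonneg x) ⟨j, hj, ?_⟩
  simpa only [star_mulVec, dotProduct_mulVec, vecMul_vecMul, Matrix.mul_assoc] using
    (hW j hj).dotProduct_mulVec_pos hjx

/-- Every covariance matrix produced by the gSPAWN covariance recursion is positive
definite. -/
theorem stmt_2 {n m d : ℕ}
    (B : Fin (n + 1) → Finset (Fin (n + 1)))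
    (hne : ∀ i : Fin (n + 1), i ≠ 0 → (B i).Nonempty)
    (G Hm : Fin (n + 1) → Fin (n + 1) → Matrix (Fin m) (Fin d) ℂ)
    (C : Fin (n + 1) → Fin (n + 1) → Matrix (Fin m) (Fin m) ℂ)
    (hC : ∀ i : Fin (n + 1), i ≠ 0 → ∀ j ∈ B i, (C i j).PosDef)
    (hGG : ∀ i : Fin (n + 1), i ≠ 0 → (∑ j ∈ B i, (G i j)ᴴ * G i j).PosDef)
    (α₀ : ℝ) (hα₀ : 0 ≤ α₀)
    (c : Fin (n + 1) → ℝ) (hc : ∀ i : Fin (n + 1), i ≠ 0 → 0 < c i)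
    (P : ℕ → Fin (n + 1) → Matrix (Fin d) (Fin d) ℂ)
    (hP0 : ∀ l, P l 0 = (α₀ : ℂ) • 1)
    (hPinit : ∀ i : Fin (n + 1), i ≠ 0 → P 0 i = (c i : ℂ) • 1)
    (hPrec : ∀ l, ∀ i : Fin (n + 1), i ≠ 0 →
      P (l + 1) i =
        (∑ j ∈ B i, (G i j)ᴴ * (C i j + Hm i j * P l j * (Hm i j)ᴴ)⁻¹ * G i j)⁻¹) :
    ∀ l, ∀ i : Fin (n + 1), i ≠ 0 → (P l i).PosDef := by
  have hP0' : ∀ l, (P l 0).PosSemidef := fun l => by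
    rw [hP0]
    exact PosSemidef.one.smul (by exact_mod_cast hα₀)
  intro l
  induction l with
  | zero =>
    intro i hi
    rw [hPinit i hi]
    exact PosDef.one.smul (by exact_mod_cast hc i hi)
  | succ l ih =>
    intro i hi
    have hPl : ∀ j, (P l j).PosSemidef := fun j => by
      by_cases hj : j = 0
      · exact hj ▸ hP0' l
      · exact (ih j hj).posSemidef
    rw [hPrec l i hi]
    exact ((hGG i hi).sum_conjTranspose_mul_mul fun j hj =>
      ((hC i hi j hj).add_posSemidef ((hPl j).mul_mul_conjTranspose_same (Hm i j))).inv).inv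
end

section
/- Under the stated assumptions, the gSPAWN covariance matrices converge: for every node i ∈ {1,…,n} there exists a positive semidefinite Hermitian matrix P_i^(∞) such that P_i^(l) → P_i^(∞) entrywise as l → ∞. -/
open Matrix Filter Topology
open scoped ComplexOrder

/-- The largest eigenvalue of a Hermitian complex matrix (0 for non-Hermitian input). -/
noncomputable def lamMax {d : ℕ} (A : Matrix (Fin d) (Fin d) ℂ) : ℝ :=
  if h : A.IsHermitian then ⨆ k, h.eigenvalues k else 0

/-- The smallest eigenvalue of a Hermitian complex matrix (0 for non-Hermitian input). -/
noncomputable def lamMin {d : ℕ} (A : Matrix (Fin d) (Fin d) ℂ) : ℝ :=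
  if h : A.IsHermitian then ⨅ k, h.eigenvalues k else 0

open scoped MatrixOrder

theorem lamMin_smul_one_le {d : ℕ} {A : Matrix (Fin d) (Fin d) ℂ} (hA : A.IsHermitian) :
    (lamMin A) • (1 : Matrix (Fin d) (Fin d) ℂ) ≤ A := by
  rw [← Algebra.algebraMap_eq_smul_one, algebraMap_le_iff_le_spectrum (ha := hA.isSelfAdjoint),
    hA.spectrum_real_eq_range_eigenvalues]
  rintro _ ⟨k, rfl⟩
  rw [lamMin, dif_pos hA]
  exact ciInf_le (Set.finite_range _).bddBelow k

theorem le_lamMax_smul_one {d : ℕ} {A : Matrix (Fin d) (Fin d) ℂ} (hA : A.IsHermitian) :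
    A ≤ (lamMax A) • (1 : Matrix (Fin d) (Fin d) ℂ) := by
  rw [← Algebra.algebraMap_eq_smul_one, le_algebraMap_iff_spectrum_le (ha := hA.isSelfAdjoint),
    hA.spectrum_real_eq_range_eigenvalues]
  rintro _ ⟨k, rfl⟩
  rw [lamMax, dif_pos hA]
  exact le_ciSup (Set.finite_range _).bddAbove k

theorem Matrix.PosDef.inv_le_inv {ι : Type*} [Fintype ι] [DecidableEq ι] {A B : Matrix ι ι ℂ}
    (hA : A.PosDef) (hAB : A ≤ B) : B⁻¹ ≤ A⁻¹ := by
  have hB : B.PosDef := by simpa using hA.add_posSemidef hAB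
  let := hA.isUnit.invertible
  let := hB.isUnit.invertible
  let := hA.inv.isUnit.invertible
  have h₁ := hB.fromBlocks₁₁ (1 : Matrix ι ι ℂ) A⁻¹
  have h₂ := hA.inv.fromBlocks₂₂ B (1 : Matrix ι ι ℂ)
  simp only [conjTranspose_one, one_mul, mul_one, inv_inv_of_invertible] at h₁ h₂
  exact h₁.1 (h₂.2 hAB)

theorem mul_mul_conjTranspose_mono {ι κ : Type*} [Fintype ι] [Fintype κ] {A B : Matrix ι ι ℂ}
    (hAB : A ≤ B) (X : Matrix κ ι ℂ) : X * A * Xᴴ ≤ X * B * Xᴴ := by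
  have := PosSemidef.mul_mul_conjTranspose_same (Matrix.le_iff.1 hAB) X
  rwa [Matrix.mul_sub, Matrix.sub_mul, ← Matrix.le_iff] at this

theorem inv_real_smul_one {ι : Type*} [Fintype ι] [DecidableEq ι] {a : ℝ} (ha : a ≠ 0) :
    (a • (1 : Matrix ι ι ℂ))⁻¹ = a⁻¹ • 1 :=
  Matrix.inv_eq_left_inv (by simp [ha])

theorem posDef_of_smul_one_le {ι : Type*} [DecidableEq ι] {A : Matrix ι ι ℂ} {a : ℝ}
    (ha : 0 < a) (h : a • 1 ≤ A) : A.PosDef := by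
  simpa using (Matrix.PosDef.one.smul ha).add_posSemidef h

theorem exists_tendsto_of_antitone {ι : Type*} [Fintype ι] [DecidableEq ι]
    {A : ℕ → Matrix ι ι ℂ} (hA : Antitone A) (h0 : ∀ l, (A l).PosSemidef) :
    ∃ L : Matrix ι ι ℂ, L.PosSemidef ∧ ∀ a b, Tendsto (fun l => A l a b) atTop (𝓝 (L a b)) := by
  have hquad (x : ι → ℂ) : ∃ z, Tendsto (fun l => star x ⬝ᵥ (A l *ᵥ x)) atTop (𝓝 z) := by
    have hanti : Antitone fun l => (star x ⬝ᵥ (A l *ᵥ x)).re := fun k l hkl => by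
      have := (Matrix.le_iff.1 (hA hkl)).re_dotProduct_nonneg x
      simpa [sub_mulVec, dotProduct_sub] using this
    have hbdd : BddBelow (Set.range fun l => (star x ⬝ᵥ (A l *ᵥ x)).re) :=
      ⟨0, by rintro _ ⟨l, rfl⟩; exact (h0 l).re_dotProduct_nonneg x⟩
    refine ⟨_, ((Complex.continuous_ofReal.tendsto _).comp
      (tendsto_atTop_ciInf hanti hbdd)).congr fun l => ?_⟩
    exact Complex.ext (by simp)
      (by simpa using (Complex.nonneg_iff.1 ((h0 l).dotProduct_mulVec_nonneg x)).2)
  choose q hq using hquad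
  have hentry (a b : ι) : ∃ z, Tendsto (fun l => A l a b) atTop (𝓝 z) := by
    let e : ι → ι → ℂ := fun i => Pi.single i 1
    refine ⟨_, ((((hq (e a + e b)).sub ((hq (e a + Complex.I • e b)).const_mul Complex.I)).sub
      (((hq (e a)).add (hq (e b))).const_mul (1 - Complex.I))).const_mul (1 / 2)).congr fun l => ?_⟩
    simp [e, mulVec_add, mulVec_smul, add_dotProduct, smul_dotProduct]
    ring_nf
    simp
    ring
  choose L hL using hentry
  have hLA : Tendsto A atTop (𝓝 (Matrix.of L)) :=
    tendsto_pi_nhds.2 fun a => tendsto_pi_nhds.2 fun b => hL a b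
  refine ⟨Matrix.of L, .of_dotProduct_mulVec_nonneg ?_ fun x => ?_, hL⟩
  · exact tendsto_nhds_unique
      (((Continuous.matrix_conjTranspose continuous_id).tendsto _).comp hLA)
      (hLA.congr fun l => (h0 l).1.symm)
  · have hc : Continuous fun M : Matrix ι ι ℂ => star x ⬝ᵥ (M *ᵥ x) := by fun_prop
    exact ge_of_tendsto' ((hc.tendsto _).comp hLA) fun l => (h0 l).dotProduct_mulVec_nonneg x

/-- The information matrix `∑ⱼ Gⱼᴴ (Cⱼ + Hⱼ Qⱼ Hⱼᴴ)⁻¹ Gⱼ` whose inverse is the next covariance. -/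
noncomputable def infoMatrix {ν ι κ : Type*} [Fintype ι] [Fintype κ] [DecidableEq κ]
    (s : Finset ν) (G H : ν → Matrix κ ι ℂ) (C : ν → Matrix κ κ ℂ) (Q : ν → Matrix ι ι ℂ) :
    Matrix ι ι ℂ :=
  ∑ j ∈ s, (G j)ᴴ * (C j + H j * Q j * (H j)ᴴ)⁻¹ * G j

section infoMatrix

variable {ν ι κ : Type*} [Fintype ι] [Fintype κ] [DecidableEq κ]
  {s : Finset ν} {G H : ν → Matrix κ ι ℂ} {C : ν → Matrix κ κ ℂ}

theorem infoMatrix_antitone {Q Q' : ν → Matrix ι ι ℂ}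
    (hC : ∀ j ∈ s, (C j).PosDef) (hQ : ∀ j ∈ s, 0 ≤ Q j) (hQQ' : ∀ j ∈ s, Q j ≤ Q' j) :
    infoMatrix s G H C Q' ≤ infoMatrix s G H C Q := by
  refine Finset.sum_le_sum fun j hj => ?_
  have hpos : (C j + H j * Q j * (H j)ᴴ).PosDef :=
    (hC j hj).add_posSemidef
      ((Matrix.nonneg_iff_posSemidef.1 (hQ j hj)).mul_mul_conjTranspose_same _)
  simpa using mul_mul_conjTranspose_mono
    (hpos.inv_le_inv (add_le_add_right (mul_mul_conjTranspose_mono (hQQ' j hj) (H j)) (C j))) (G j)ᴴ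

theorem smul_one_le_infoMatrix [DecidableEq ι] {Q : ν → Matrix ι ι ℂ} {α c ρ η : ℝ}
    (hα : 0 < α) (hρ : 0 < ρ) (hc : 0 ≤ c)
    (hC : ∀ j ∈ s, (C j).PosDef) (hCle : ∀ j ∈ s, C j ≤ (α * ρ) • 1)
    (hH : ∀ j ∈ s, H j * (H j)ᴴ ≤ ρ • 1) (hG : η • 1 ≤ ∑ j ∈ s, (G j)ᴴ * G j)
    (hQ : ∀ j ∈ s, 0 ≤ Q j) (hQle : ∀ j ∈ s, Q j ≤ (c * α) • 1) :
    (((1 + c) * α * ρ)⁻¹ * η) • 1 ≤ infoMatrix s G H C Q := by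
  have hpos : 0 < (1 + c) * α * ρ := by positivity
  rw [mul_smul]
  refine (smul_le_smul_of_nonneg_left hG (inv_nonneg.2 hpos.le)).trans ?_
  rw [Finset.smul_sum]
  refine Finset.sum_le_sum fun j hj => ?_
  have hposDef : (C j + H j * Q j * (H j)ᴴ).PosDef :=
    (hC j hj).add_posSemidef
      ((Matrix.nonneg_iff_posSemidef.1 (hQ j hj)).mul_mul_conjTranspose_same _)
  have hle : C j + H j * Q j * (H j)ᴴ ≤ ((1 + c) * α * ρ) • 1 :=
    calc C j + H j * Q j * (H j)ᴴ
        ≤ (α * ρ) • 1 + H j * ((c * α) • 1) * (H j)ᴴ :=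
          add_le_add (hCle j hj) (mul_mul_conjTranspose_mono (hQle j hj) (H j))
      _ = (α * ρ) • 1 + (c * α) • (H j * (H j)ᴴ) := by simp
      _ ≤ (α * ρ) • 1 + (c * α) • (ρ • 1) := by
          gcongr
          exact hH j hj
      _ = ((1 + c) * α * ρ) • 1 := by
          rw [smul_smul, ← add_smul]
          congr 1
          ring
  have hinv := hposDef.inv_le_inv hle
  rw [inv_real_smul_one hpos.ne'] at hinv
  simpa using mul_mul_conjTranspose_mono hinv (G j)ᴴ

end infoMatrix

/-- In a connected symmetric graph, two degree-one neighbours span the whole graph, so two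
neighbours that both differ from a vertex `r` do not both have degree one. -/
theorem card_ne_one_of_mem_of_card_eq_one {V : Type*} {B : V → Finset V} {r i j : V}
    (hsym : ∀ i j, j ∈ B i ↔ i ∈ B j)
    (hconn : ∀ i j, Relation.ReflTransGen (fun a b => b ∈ B a) i j)
    (hi : i ≠ r) (hj : j ≠ r) (hij : j ∈ B i) (hcard : (B i).card = 1) : (B j).card ≠ 1 := by
  intro hcard'
  obtain ⟨x, hx⟩ := Finset.card_eq_one.1 hcard
  obtain ⟨y, hy⟩ := Finset.card_eq_one.1 hcard'
  have hji := (hsym i j).1 hij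
  simp only [hx, hy, Finset.mem_singleton] at hij hji
  subst hij hji
  have hreach : ∀ k, Relation.ReflTransGen (fun a b => b ∈ B a) i k → k = i ∨ k = j := by
    intro k hk
    induction hk with
    | refl => exact .inl rfl
    | tail _ hbc ih => rcases ih with rfl | rfl <;> simp_all
  rcases hreach r (hconn i r) with h | h
  · exact hi h.symm
  · exact hj h.symm

/-- Under Assumptions 1 and 2 of the paper, the gSPAWN covariance matrices converge:
for every node `i ≥ 1` there is a positive semidefinite Hermitian matrix `P_i^∞` such
that `P_i^(l) → P_i^∞` entrywise as `l → ∞`. -/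
theorem stmt_3 {n m d : ℕ} (hd : 0 < d)
    (B : Fin (n + 1) → Finset (Fin (n + 1)))
    (hsym : ∀ i j : Fin (n + 1), j ∈ B i ↔ i ∈ B j)
    (hne : ∀ i : Fin (n + 1), i ≠ 0 → (B i).Nonempty)
    (hconn : ∀ i j : Fin (n + 1), Relation.ReflTransGen (fun a b => b ∈ B a) i j)
    (G Hm : Fin (n + 1) → Fin (n + 1) → Matrix (Fin m) (Fin d) ℂ)
    (C : Fin (n + 1) → Fin (n + 1) → Matrix (Fin m) (Fin m) ℂ)
    (hC : ∀ i : Fin (n + 1), i ≠ 0 → ∀ j ∈ B i, (C i j).PosDef)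
    -- η_i² = λ_min(∑_{j ∈ B_i} G_{ij}ᴴ G_{ij}) > 0
    (η2 : Fin (n + 1) → ℝ)
    (hη2 : ∀ i : Fin (n + 1), i ≠ 0 → η2 i = lamMin (∑ j ∈ B i, (G i j)ᴴ * G i j))
    (hη2pos : ∀ i : Fin (n + 1), i ≠ 0 → 0 < η2 i)
    -- ρ_i² = max_{j ∈ B_i} λ_max(H̄_{ij} H̄_{ij}ᴴ) > 0
    (ρ2 : Fin (n + 1) → ℝ)
    (hρ2ub : ∀ i : Fin (n + 1), i ≠ 0 → ∀ j ∈ B i, lamMax (Hm i j * (Hm i j)ᴴ) ≤ ρ2 i)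
    (hρ2mem : ∀ i : Fin (n + 1), i ≠ 0 → ∃ j ∈ B i, ρ2 i = lamMax (Hm i j * (Hm i j)ᴴ))
    (hρ2pos : ∀ i : Fin (n + 1), i ≠ 0 → 0 < ρ2 i)
    -- ρ_i² ≤ η_i²/|B_i| when |B_i| ≤ 2, ρ_i² ≤ η_i²/3 when |B_i| ≥ 3
    (hratio1 : ∀ i : Fin (n + 1), i ≠ 0 → (B i).card ≤ 2 → ρ2 i ≤ η2 i / (B i).card)
    (hratio2 : ∀ i : Fin (n + 1), i ≠ 0 → 3 ≤ (B i).card → ρ2 i ≤ η2 i / 3)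
    -- α ≥ α₀ ≥ 0, α > 0, α ≥ (max_{i,j} λ_max(C_{ij})) / (min_i ρ_i²)
    (α α₀ : ℝ) (hαpos : 0 < α) (hα₀ : 0 ≤ α₀) (hαα₀ : α₀ ≤ α)
    (hαC : ∀ i : Fin (n + 1), i ≠ 0 → ∀ j ∈ B i, ∀ i' : Fin (n + 1), i' ≠ 0 →
      lamMax (C i j) / ρ2 i' ≤ α)
    -- the gSPAWN covariance recursion
    (P : ℕ → Fin (n + 1) → Matrix (Fin d) (Fin d) ℂ)
    (hP0 : ∀ l, P l 0 = (α₀ : ℂ) • 1)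
    (hPinit : ∀ i : Fin (n + 1), i ≠ 0 → P 0 i =
      (if (B i).card = 1 then ((4 * α : ℝ) : ℂ)
       else if (B i).card = 2 then ((3 * α : ℝ) : ℂ)
       else ((5 * α / 3 : ℝ) : ℂ)) • 1)
    (hPrec : ∀ l, ∀ i : Fin (n + 1), i ≠ 0 →
      P (l + 1) i =
        (∑ j ∈ B i, (G i j)ᴴ * (C i j + Hm i j * P l j * (Hm i j)ᴴ)⁻¹ * G i j)⁻¹) :
    ∀ i : Fin (n + 1), i ≠ 0 → ∃ Pinf : Matrix (Fin d) (Fin d) ℂ,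
      Pinf.PosSemidef ∧ ∀ a b, Tendsto (fun l => P l i a b) atTop (𝓝 (Pinf a b)) := by
  have hHle : ∀ i, i ≠ 0 → ∀ j ∈ B i, Hm i j * (Hm i j)ᴴ ≤ ρ2 i • 1 := fun i hi j hj =>
    (le_lamMax_smul_one (isHermitian_mul_conjTranspose_self _)).trans
      (smul_le_smul_of_nonneg_right (hρ2ub i hi j hj) zero_le_one)
  have hCle : ∀ i, i ≠ 0 → ∀ j ∈ B i, C i j ≤ (α * ρ2 i) • 1 := fun i hi j hj =>
    (le_lamMax_smul_one (hC i hi j hj).1).trans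
      (smul_le_smul_of_nonneg_right
        ((div_le_iff₀ (hρ2pos i hi)).1 (hαC i hi j hj i hi)) zero_le_one)
  have hGle : ∀ i, i ≠ 0 → η2 i • 1 ≤ ∑ j ∈ B i, (G i j)ᴴ * G i j := fun i hi => by
    rw [hη2 i hi]
    exact lamMin_smul_one_le
      (isSelfAdjoint_sum _ fun j _ => isHermitian_conjTranspose_mul_self (G i j))
  have hinfo (i) (hi : i ≠ 0) (c : ℝ) (hc : 0 ≤ c) (Q : Fin (n + 1) → Matrix (Fin d) (Fin d) ℂ)
      (hQ : ∀ j ∈ B i, 0 ≤ Q j) (hQle : ∀ j ∈ B i, Q j ≤ (c * α) • 1) :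
      (((1 + c) * α * ρ2 i)⁻¹ * η2 i) • 1 ≤ infoMatrix (B i) (G i) (Hm i) (C i) Q :=
    smul_one_le_infoMatrix hαpos (hρ2pos i hi) hc (hC i hi) (hCle i hi) (hHle i hi) (hGle i hi)
      hQ hQle
  have hcoef (i) (hi : i ≠ 0) (c : ℝ) (hc : 0 ≤ c) : 0 < ((1 + c) * α * ρ2 i)⁻¹ * η2 i := by
    have := hρ2pos i hi
    have := hη2pos i hi
    positivity
  let c₀ : Fin (n + 1) → ℝ := fun i =>
    if i = 0 then α₀ / α else if (B i).card = 1 then 4 else if (B i).card = 2 then 3 else 5 / 3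
  have hP0eq (i) : P 0 i = (c₀ i * α) • 1 := by
    by_cases hi : i = 0
    · subst hi
      rw [hP0, ← Complex.coe_smul]
      simp [c₀, hαpos.ne']
    · rw [hPinit i hi, ← Complex.coe_smul]
      simp only [c₀, hi, if_false]
      split_ifs <;> simp [mul_div_right_comm]
  have hα₀1 : α₀ / α ≤ 1 := (div_le_one hαpos).2 hαα₀
  have hc₀nonneg (i) : 0 ≤ c₀ i := by
    simp only [c₀]
    split_ifs <;> positivity
  have hc₀le (i) : c₀ i ≤ 4 := by
    simp only [c₀]
    split_ifs <;> linarith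
  have hP0nonneg (i) : 0 ≤ P 0 i := by
    rw [hP0eq]
    exact smul_nonneg (mul_nonneg (hc₀nonneg i) hαpos.le) zero_le_one
  have hfirst (i) (hi : i ≠ 0) : P 1 i ≤ P 0 i := by
    obtain ⟨c, hc, hcj, hci⟩ : ∃ c : ℝ, 0 ≤ c ∧ (∀ j ∈ B i, c₀ j ≤ c) ∧
        (1 + c) * ρ2 i ≤ c₀ i * η2 i := by
      have hη := hη2pos i hi
      by_cases h1 : (B i).card = 1
      · refine ⟨3, by norm_num, fun j hj => ?_, ?_⟩
        · by_cases hj0 : j = 0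
          · simp only [c₀, hj0, if_true]
            linarith
          · have := card_ne_one_of_mem_of_card_eq_one hsym hconn hi hj0 hj h1
            simp only [c₀, hj0, this, if_false]
            split_ifs <;> norm_num
        · have := hratio1 i hi (by omega)
          simp only [h1, Nat.cast_one, div_one] at this
          simp only [c₀, hi, h1, if_false, if_true]
          linarith
      · refine ⟨4, by norm_num, fun j _ => hc₀le j, ?_⟩
        by_cases h2 : (B i).card = 2
        · have := hratio1 i hi (by omega)
          simp only [h2, Nat.cast_ofNat] at this
          simp only [c₀, hi, h2, if_false, if_true]
          norm_num
          linarith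
        · have := hratio2 i hi (by have := (hne i hi).card_pos; omega)
          simp only [c₀, hi, h1, h2, if_false]
          linarith
    have hlow := hinfo i hi c hc (P 0) (fun j _ => hP0nonneg j) fun j hj => by
      rw [hP0eq]
      exact smul_le_smul_of_nonneg_right
        (mul_le_mul_of_nonneg_right (hcj j hj) hαpos.le) zero_le_one
    have hlow' := (Matrix.PosDef.one.smul (hcoef i hi c hc)).inv_le_inv hlow
    rw [inv_real_smul_one (hcoef i hi c hc).ne'] at hlow'
    rw [hPrec 0 i hi, hP0eq]
    refine hlow'.trans (smul_le_smul_of_nonneg_right ?_ zero_le_one)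
    rw [mul_inv, inv_inv, ← div_eq_mul_inv, div_le_iff₀ (hη2pos i hi)]
    nlinarith [mul_le_mul_of_nonneg_left hci hαpos.le]
  have hP0le (i) : P 0 i ≤ (4 * α) • 1 := by
    rw [hP0eq]
    exact smul_le_smul_of_nonneg_right
      (mul_le_mul_of_nonneg_right (hc₀le i) hαpos.le) zero_le_one
  have hinfoPos (l) (h0 : ∀ i, 0 ≤ P l i) (h4 : ∀ i, P l i ≤ (4 * α) • 1) (i) (hi : i ≠ 0) :
      (infoMatrix (B i) (G i) (Hm i) (C i) (P l)).PosDef :=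
    posDef_of_smul_one_le (hcoef i hi 4 (by norm_num))
      (hinfo i hi 4 (by norm_num) _ (fun j _ => h0 j) fun j _ => h4 j)
  have hinv (l) : (∀ i, 0 ≤ P l i) ∧ (∀ i, P l i ≤ (4 * α) • 1) ∧ ∀ i, P (l + 1) i ≤ P l i := by
    induction l with
    | zero =>
      refine ⟨hP0nonneg, hP0le, fun i => ?_⟩
      by_cases hi : i = 0
      · rw [hi, hP0, hP0]
      · exact hfirst i hi
    | succ l ih =>
      obtain ⟨h0, h4, hdec⟩ := ih
      have h0' : ∀ i, 0 ≤ P (l + 1) i := fun i => by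
        by_cases hi : i = 0
        · rw [hi, hP0, ← hP0 l]
          exact h0 0
        · rw [hPrec l i hi]
          exact (hinfoPos l h0 h4 i hi).inv.posSemidef.nonneg
      refine ⟨h0', fun i => (hdec i).trans (h4 i), fun i => ?_⟩
      by_cases hi : i = 0
      · rw [hi, hP0, hP0]
      · rw [hPrec (l + 1) i hi, hPrec l i hi]
        exact (hinfoPos l h0 h4 i hi).inv_le_inv
          (infoMatrix_antitone (hC i hi) (fun j _ => h0' j) fun j _ => hdec j)
  intro i _
  exact exists_tendsto_of_antitone (antitone_nat_of_succ_le fun l => (hinv l).2.2 i)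
    fun l => Matrix.nonneg_iff_posSemidef.1 ((hinv l).1 i)
end

section
/- Let (Q^(l))_{l≥1} be deterministic N×N complex matrices converging entrywise to a matrix Q^(∞) with spectral radius r(Q^(∞)) < 1. On a probability space, let (x_l)_{l≥0} be integrable random vectors in ℂ^N satisfying x_l = Q̂_l x_{l−1} + n_l for l ≥ 1, where for each l the random matrix Q̂_l is integrable, independent of x_{l−1}, and satisfies E[Q̂_l] = Q^(l), and the random vector n_l is integrable with E[n_l] = 0. Then E[x_l] → 0 as l → ∞. -/
open Matrix Filter Topology MeasureTheory ProbabilityTheory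
open scoped ENNReal

/-- A nonnegative sequence that eventually contracts by a fixed factor over every window of length
`k` tends to zero. -/
theorem tendsto_zero_of_window_contraction {a : ℕ → ℝ} (ha : ∀ n, 0 ≤ a n) {q : ℝ} (hq0 : 0 ≤ q)
    (hq1 : q < 1) {k : ℕ} (hk : 0 < k) (h : ∀ᶠ n in atTop, a (n + k) ≤ q * a n) :
    Tendsto a atTop (𝓝 0) := by
  obtain ⟨L, hL⟩ := eventually_atTop.1 h
  have hiter : ∀ s m, a (L + s + k * m) ≤ q ^ m * a (L + s) := by
    intro s m
    induction m with
    | zero => simp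
    | succ m ih =>
      calc a (L + s + k * (m + 1)) = a (L + s + k * m + k) := by rw [mul_add_one, ← add_assoc]
        _ ≤ q * a (L + s + k * m) := hL _ (by omega)
        _ ≤ q * (q ^ m * a (L + s)) := by gcongr
        _ = q ^ (m + 1) * a (L + s) := by ring
  have hbound : ∀ n, a (n + L) ≤ q ^ (n / k) * ∑ s ∈ Finset.range k, a (L + s) := by
    intro n
    have h1 := hiter (n % k) (n / k)
    rw [add_assoc, Nat.mod_add_div, add_comm] at h1
    refine h1.trans ?_
    gcongr
    exact Finset.single_le_sum (f := fun s => a (L + s)) (fun s _ => ha _)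
      (Finset.mem_range.2 (Nat.mod_lt n hk))
  have hlim : Tendsto (fun n => q ^ (n / k) * ∑ s ∈ Finset.range k, a (L + s)) atTop (𝓝 0) := by
    simpa using ((tendsto_pow_atTop_nhds_zero_of_lt_one hq0 hq1).comp
      (Nat.tendsto_div_const_atTop hk.ne')).mul_const (∑ s ∈ Finset.range k, a (L + s))
  exact (tendsto_add_atTop_iff_nat L).1 (squeeze_zero (fun n => ha _) hbound hlim)

/-- In a complex Banach algebra, an element of spectral radius less than one has a positive power
of norm less than one. -/
theorem exists_norm_pow_lt_one_of_spectralRadius_lt_one {R : Type*} [NormedRing R]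
    [NormedAlgebra ℂ R] [CompleteSpace R] {b : R} (hb : spectralRadius ℂ b < 1) :
    ∃ k, 0 < k ∧ ‖b ^ k‖ < 1 := by
  have h := (spectrum.pow_nnnorm_pow_one_div_tendsto_nhds_spectralRadius b).eventually_lt_const hb
  obtain ⟨k, hk, hk0⟩ := (h.and (eventually_gt_atTop 0)).exists
  refine ⟨k, hk0, ?_⟩
  by_contra! hge
  refine hk.not_ge (ENNReal.one_le_rpow ?_ (by positivity))
  exact_mod_cast hge

/-- In a complex Banach algebra, a solution of `p (l + 1) = a (l + 1) * p l` tends to zero as soon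
as `a` converges to an element of spectral radius less than one. -/
theorem tendsto_zero_of_recurrence_of_spectralRadius_lt_one {R : Type*} [NormedRing R]
    [NormedAlgebra ℂ R] [CompleteSpace R] {a p : ℕ → R} {b : R} (ha : Tendsto a atTop (𝓝 b))
    (hb : spectralRadius ℂ b < 1) (hp : ∀ l, p (l + 1) = a (l + 1) * p l) :
    Tendsto p atTop (𝓝 0) := by
  obtain ⟨k, hk, hbk⟩ := exists_norm_pow_lt_one_of_spectralRadius_lt_one hb
  have hwindow : ∀ m, ∃ w : ℕ → R, Tendsto w atTop (𝓝 (b ^ m)) ∧ ∀ l, p (l + m) = w l * p l := by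
    intro m
    induction m with
    | zero => exact ⟨fun _ => 1, by simp, by simp⟩
    | succ m ih =>
      obtain ⟨w, hw, hwp⟩ := ih
      refine ⟨fun l => a (l + (m + 1)) * w l, ?_, fun l => ?_⟩
      · rw [pow_succ']
        exact ((tendsto_add_atTop_iff_nat (m + 1)).2 ha).mul hw
      · rw [← add_assoc, hp, hwp, mul_assoc, add_assoc]
  obtain ⟨w, hw, hwp⟩ := hwindow k
  obtain ⟨q, hbq, hq1⟩ := exists_between hbk
  rw [tendsto_zero_iff_norm_tendsto_zero]
  refine tendsto_zero_of_window_contraction (fun n => norm_nonneg _)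
    ((norm_nonneg _).trans hbq.le) hq1 hk ?_
  filter_upwards [hw.norm.eventually_lt_const hbq] with l hl
  rw [hwp]
  exact (norm_mul_le _ _).trans (by gcongr)

section MatrixNorm

attribute [local instance] Matrix.linftyOpNormedRing Matrix.linftyOpNormedAlgebra

/-- A solution of `v (l + 1) = Q (l + 1) *ᵥ v l` tends to zero as soon as `Q` converges entrywise to
a matrix of spectral radius less than one. -/
theorem tendsto_zero_of_mulVec_recurrence {n : Type*} [Fintype n] [DecidableEq n]
    {Q : ℕ → Matrix n n ℂ} {Qinf : Matrix n n ℂ}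
    (hQ : ∀ i j, Tendsto (fun l => Q l i j) atTop (𝓝 (Qinf i j)))
    (hr : spectralRadius ℂ Qinf < 1) {v : ℕ → n → ℂ} (hv : ∀ l, v (l + 1) = Q (l + 1) *ᵥ v l)
    (i : n) : Tendsto (fun l => v l i) atTop (𝓝 0) := by
  have hQ' : Tendsto Q atTop (𝓝 Qinf) := tendsto_pi_nhds.2 fun i => tendsto_pi_nhds.2 (hQ i)
  have hlim := tendsto_zero_of_recurrence_of_spectralRadius_lt_one
    (p := fun l => Matrix.replicateCol n (v l)) hQ' hr
    (fun l => by rw [hv, Matrix.replicateCol_mulVec])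
  exact tendsto_pi_nhds.1 (tendsto_pi_nhds.1 hlim i) i

end MatrixNorm

/-- Expectation of a random matrix applied to an independent random vector. -/
theorem integral_mulVec_of_indepFun {m n : Type*} [Fintype n] {Ω : Type*} [MeasurableSpace Ω]
    {μ : Measure Ω} {A : Ω → m → n → ℂ} {x : Ω → n → ℂ} (hindep : IndepFun A x μ)
    (hA : ∀ i j, Integrable (fun ω => A ω i j) μ) (hx : ∀ j, Integrable (fun ω => x ω j) μ)
    (i : m) :
    Integrable (fun ω => (Matrix.of (A ω) *ᵥ x ω) i) μ ∧
      ∫ ω, (Matrix.of (A ω) *ᵥ x ω) i ∂μ =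
        ∑ j, (∫ ω, A ω i j ∂μ) * ∫ ω, x ω j ∂μ := by
  have hentry : ∀ j, IndepFun (fun ω => A ω i j) (fun ω => x ω j) μ := fun j =>
    hindep.comp (φ := fun M : m → n → ℂ => M i j) (ψ := fun y : n → ℂ => y j)
      (by fun_prop) (by fun_prop)
  have hmul : ∀ j, Integrable (fun ω => A ω i j * x ω j) μ := fun j =>
    (hentry j).integrable_mul (hA i j) (hx j)
  simp only [Matrix.mulVec, dotProduct, Matrix.of_apply]
  refine ⟨integrable_finsetSum _ fun j _ => hmul j, ?_⟩
  rw [integral_finsetSum _ fun j _ => hmul j]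
  exact Finset.sum_congr rfl fun j _ =>
    (hentry j).integral_fun_mul_eq_mul_integral (hA i j).aestronglyMeasurable
      (hx j).aestronglyMeasurable

/-- If `x_l = Q̂_l x_{l-1} + n_l` with `Q̂_l` independent of `x_{l-1}`,
`E[Q̂_l] = Q^(l) → Q^(∞)` with `r(Q^(∞)) < 1` and `E[n_l] = 0`, then `E[x_l] → 0`. -/
theorem stmt_11 {N : ℕ}
    (Q : ℕ → Matrix (Fin N) (Fin N) ℂ) (Qinf : Matrix (Fin N) (Fin N) ℂ)
    (hQconv : ∀ i j, Tendsto (fun l => Q l i j) atTop (𝓝 (Qinf i j)))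
    (hr : spectralRadius ℂ Qinf < 1)
    {Ω : Type*} [MeasurableSpace Ω] (μ : Measure Ω) [IsProbabilityMeasure μ]
    (Qhat : ℕ → Ω → (Fin N → Fin N → ℂ))
    (x : ℕ → Ω → (Fin N → ℂ))
    (nv : ℕ → Ω → (Fin N → ℂ))
    (hrec : ∀ l ω, x (l + 1) ω = (Matrix.of (Qhat (l + 1) ω)).mulVec (x l ω) + nv (l + 1) ω)
    (hxint : ∀ l i, Integrable (fun ω => x l ω i) μ)
    (hQint : ∀ l i j, Integrable (fun ω => Qhat (l + 1) ω i j) μ)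
    (hnint : ∀ l i, Integrable (fun ω => nv (l + 1) ω i) μ)
    (hindep : ∀ l, IndepFun (Qhat (l + 1)) (x l) μ)
    (hQmean : ∀ l i j, ∫ ω, Qhat (l + 1) ω i j ∂μ = Q (l + 1) i j)
    (hnmean : ∀ l i, ∫ ω, nv (l + 1) ω i ∂μ = 0) :
    ∀ i, Tendsto (fun l => ∫ ω, x l ω i ∂μ) atTop (𝓝 0) := by
  refine tendsto_zero_of_mulVec_recurrence (v := fun l i => ∫ ω, x l ω i ∂μ) hQconv hr fun l => ?_
  funext i
  obtain ⟨hint, hval⟩ := integral_mulVec_of_indepFun (hindep l) (hQint l) (hxint l) i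
  simp only [hrec, Pi.add_apply]
  rw [integral_add hint (hnint l i), hnmean, add_zero, hval]
  simp only [hQmean, Matrix.mulVec, dotProduct]
end

section
/- Suppose in addition to the assumptions of the gSPAWN localization covariance recursion that there exists a 2×2 unitary matrix U such that U^* C_{ij} U is a diagonal matrix with positive real diagonal entries for all i ≥ 1 and j ∈ B_i. Let s_0, s_1, …, s_n ∈ ℂ² be the true node locations, and on a probability space let ω_{ij} (i ≥ 1, j ∈ B_i) be integrable random vectors in ℂ² with E[ω_{ij}] = 0, and set d_{ij} = s_i − s_j + ω_{ij}. Run the gSPAWN mean recursion: μ_0^(l) = s_0 for all l ≥ 0; μ_i^(0) = 0 for i ≥ 1; and for l ≥ 1 and i ≥ 1, μ_i^(l) = P_i^(l) Σ_{j∈B_i} (C_{ij} + P_j^(l−1))⁻¹ (μ_j^(l−1) + d_{ij}), with the P_i^(l) given by the gSPAWN localization covariance recursion with α₀ = 0. Then for every i ∈ {1,…,n}, E[μ_i^(l)] → s_i as l → ∞. -/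
open Matrix Filter Topology MeasureTheory
open scoped ComplexOrder

section Graph

variable {V : Type*}

/-- `i` is joined to `r` by a walk with the given number of steps. -/
def ReachesIn (B : V → Finset V) (r : V) : ℕ → V → Prop
  | 0, i => i = r
  | m + 1, i => ∃ j ∈ B i, ReachesIn B r m j

/-- If every node reaches `r`, some rank function strictly decreases along a suitable neighbor
of each node other than `r`. -/
lemma exists_rank_of_reachable (B : V → Finset V) (r : V)
    (h : ∀ i, Relation.ReflTransGen (fun a b => b ∈ B a) i r) :
    ∃ k : V → ℕ, ∀ i, i ≠ r → ∃ j ∈ B i, k j < k i := by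
  classical
  have hS : ∀ i, ∃ m, ReachesIn B r m i := fun i =>
    (h i).head_induction_on (motive := fun a _ => ∃ m, ReachesIn B r m a) ⟨0, rfl⟩
      (fun {a b} hab _ ⟨m, hm⟩ => ⟨m + 1, b, hab, hm⟩)
  refine ⟨fun i => Nat.find (hS i), fun i hi => ?_⟩
  have hspec : ReachesIn B r (Nat.find (hS i)) i := Nat.find_spec (hS i)
  rcases hm : Nat.find (hS i) with _ | m
  · rw [hm] at hspec
    exact absurd hspec hi
  · rw [hm] at hspec
    obtain ⟨j, hj, hjm⟩ := hspec
    exact ⟨j, hj, (Nat.lt_succ_of_le (Nat.find_min' (hS j) hjm)).trans_eq hm.symm⟩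

/-- Iterated averaging with edge weights bounded below, absorbed at a root which is reachable
from every node, converges to zero. -/
lemma tendsto_zero_of_averaging [Fintype V] (B : V → Finset V) (r : V)
    (h : ∀ i, Relation.ReflTransGen (fun a b => b ∈ B a) i r)
    {δ : ℝ} (hδ : 0 < δ) (W : ℕ → V → V → ℝ)
    (hW : ∀ l i, i ≠ r → ∀ j ∈ B i, δ ≤ W l i j)
    (hsum : ∀ l i, i ≠ r → ∑ j ∈ B i, W l i j = 1)
    (e : ℕ → V → ℂ) (her : ∀ l, e l r = 0)
    (he : ∀ l i, i ≠ r → e (l + 1) i = ∑ j ∈ B i, (W l i j : ℂ) * e l j) (i : V) :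
    Tendsto (fun l => e l i) atTop (𝓝 0) := by
  obtain ⟨k, hk⟩ := exists_rank_of_reachable B r h
  obtain ⟨N, hN⟩ : ∃ N, ∀ i, k i ≤ N :=
    ⟨Finset.univ.sup k, fun i => Finset.le_sup (Finset.mem_univ i)⟩
  set t : ℝ := min δ 1 / 2 with ht
  have ht0 : 0 < t := by positivity
  have ht1 : t ≤ 1 := by have := min_le_right δ 1; linarith
  have htδ : 2 * t ≤ δ := by have := min_le_left δ 1; linarith
  have hpow1 : ∀ m, t ^ m ≤ 1 := fun m => pow_le_one₀ ht0.le ht1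
  have hpow0 : ∀ m, 0 < t ^ m := fun m => pow_pos ht0 m
  set ρ : ℝ := 1 - t ^ N / 2 with hρ
  have hρ0 : 0 ≤ ρ := by have := hpow1 N; linarith
  have hρ1 : ρ < 1 := by have := hpow0 N; linarith
  have hstep : ∀ l i, i ≠ r → ∑ j ∈ B i, W l i j * (2 - t ^ k j) ≤ ρ * (2 - t ^ k i) := by
    intro l i hi
    obtain ⟨j, hj, hji⟩ := hk i hi
    have h1 : W l i j * t ^ k j ≤ ∑ j ∈ B i, W l i j * t ^ k j :=
      Finset.single_le_sum (f := fun j => W l i j * t ^ k j)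
        (fun q hq => mul_nonneg (hδ.le.trans (hW l i hi q hq)) (hpow0 _).le) hj
    have h2 : ∑ j ∈ B i, W l i j * (2 - t ^ k j) = 2 - ∑ j ∈ B i, W l i j * t ^ k j := by
      simp only [mul_sub, Finset.sum_sub_distrib, ← Finset.sum_mul, hsum l i hi, one_mul]
    have h3 : 2 * t ^ k i ≤ W l i j * t ^ k j := by
      calc 2 * t ^ k i ≤ 2 * t ^ (k j + 1) := by
            have := pow_le_pow_of_le_one ht0.le ht1 (Nat.succ_le_of_lt hji)
            simpa using this
        _ = 2 * t * t ^ k j := by ring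
        _ ≤ _ := mul_le_mul_of_nonneg_right (htδ.trans (hW l i hi j hj)) (hpow0 _).le
    have h4 : t ^ N ≤ t ^ k i := pow_le_pow_of_le_one ht0.le ht1 (hN i)
    have := mul_pos (hpow0 N) (hpow0 (k i))
    rw [h2, hρ]
    nlinarith
  obtain ⟨M, hM0, hM⟩ : ∃ M : ℝ, 0 ≤ M ∧ ∀ i, ‖e 0 i‖ ≤ M :=
    ⟨∑ i, ‖e 0 i‖, by positivity, fun i =>
      Finset.single_le_sum (f := fun i => ‖e 0 i‖) (fun _ _ => norm_nonneg _) (Finset.mem_univ i)⟩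
  have hbound : ∀ l i, ‖e l i‖ ≤ M * ρ ^ l * (2 - t ^ k i) := by
    intro l
    induction l with
    | zero => intro i; have := hM i; have := hpow1 (k i); simp only [pow_zero]; nlinarith
    | succ l ih =>
      intro i
      by_cases hi : i = r
      · have := hpow1 (k i)
        rw [hi, her, norm_zero, ← hi]
        exact mul_nonneg (mul_nonneg hM0 (pow_nonneg hρ0 _)) (by linarith)
      · rw [he l i hi]
        calc ‖∑ j ∈ B i, (W l i j : ℂ) * e l j‖
            ≤ ∑ j ∈ B i, M * ρ ^ l * (W l i j * (2 - t ^ k j)) := by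
              refine norm_sum_le_of_le _ fun j hj => ?_
              have hw := hδ.le.trans (hW l i hi j hj)
              rw [norm_mul, Complex.norm_real, Real.norm_of_nonneg hw]
              calc _ ≤ W l i j * (M * ρ ^ l * (2 - t ^ k j)) :=
                    mul_le_mul_of_nonneg_left (ih j) hw
                _ = _ := by ring
          _ ≤ M * ρ ^ l * (ρ * (2 - t ^ k i)) := by
              rw [← Finset.mul_sum]
              exact mul_le_mul_of_nonneg_left (hstep l i hi) (mul_nonneg hM0 (pow_nonneg hρ0 _))
          _ = _ := by ring
  refine squeeze_zero_norm (a := fun l => M * ρ ^ l * (2 - t ^ k i)) (fun l => hbound l i) ?_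
  simpa using ((tendsto_pow_atTop_nhds_zero_of_lt_one hρ0 hρ1).const_mul M).mul_const (2 - t ^ k i)

/-- In a symmetric graph where every node reaches `r`, two nodes other than `r` cannot be each
other's only neighbor. -/
lemma card_ne_one_of_reachable (B : V → Finset V) (r : V)
    (hsym : ∀ i j, j ∈ B i ↔ i ∈ B j)
    (h : ∀ i, Relation.ReflTransGen (fun a b => b ∈ B a) i r)
    {i j : V} (hi : i ≠ r) (hj : j ≠ r) (hB : B i = {j}) : (B j).card ≠ 1 := by
  intro hc
  obtain ⟨q, hq⟩ := Finset.card_eq_one.mp hc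
  have hiq : i ∈ B j := (hsym i j).mp (by simp [hB])
  have hq' : B j = {i} := by
    rw [hq, Finset.mem_singleton] at hiq
    rw [hq, hiq]
  have key : ∀ v, Relation.ReflTransGen (fun a b => b ∈ B a) i v → v = i ∨ v = j := by
    intro v hv
    induction hv with
    | refl => exact Or.inl rfl
    | tail _ hbc ih =>
      rcases ih with rfl | rfl
      · exact Or.inr (by simpa [hB] using hbc)
      · exact Or.inl (by simpa [hq'] using hbc)
  rcases key r (h i) with h' | h'
  · exact hi h'.symm
  · exact hj h'.symm

/-- The harmonic-type sum `(∑ x⁻¹)⁻¹` over `m` or more terms in `(0, X]` is at most `X / m`. -/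
lemma inv_sum_inv_le (s : Finset V) (x : V → ℝ) {X : ℝ} {m : ℕ} (hm : 0 < m) (hs : m ≤ s.card)
    (hx0 : ∀ j ∈ s, 0 < x j) (hx : ∀ j ∈ s, x j ≤ X) : (∑ j ∈ s, (x j)⁻¹)⁻¹ ≤ X / m := by
  obtain ⟨j, hj⟩ := Finset.card_pos.mp (hm.trans_le hs)
  have hX : 0 < X := (hx0 j hj).trans_le (hx j hj)
  have hm' : (0 : ℝ) < m := by exact_mod_cast hm
  have h1 : (s.card : ℝ) * X⁻¹ ≤ ∑ j ∈ s, (x j)⁻¹ := by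
    rw [← nsmul_eq_mul]
    exact Finset.card_nsmul_le_sum _ _ _ fun j hj => inv_anti₀ (hx0 j hj) (hx j hj)
  have h2 : (m : ℝ) * X⁻¹ ≤ ∑ j ∈ s, (x j)⁻¹ :=
    (mul_le_mul_of_nonneg_right (by exact_mod_cast hs) (inv_nonneg.mpr hX.le)).trans h1
  calc _ ≤ ((m : ℝ) * X⁻¹)⁻¹ := inv_anti₀ (by positivity) h2
    _ = _ := by rw [mul_inv, inv_inv, div_eq_inv_mul]

/-- The scalar covariance recursion stays in a bounded interval. -/
lemma scalar_covariance_bounds (B : V → Finset V) (r : V)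
    (hsym : ∀ i j, j ∈ B i ↔ i ∈ B j) (hne : ∀ i, i ≠ r → (B i).Nonempty)
    (h : ∀ i, Relation.ReflTransGen (fun a b => b ∈ B a) i r)
    (c : V → V → ℝ) {β : ℝ} (hβ : 0 < β)
    (hc0 : ∀ i, i ≠ r → ∀ j ∈ B i, 0 < c i j) (hcβ : ∀ i, i ≠ r → ∀ j ∈ B i, c i j ≤ β)
    (p : ℕ → V → ℝ) (hpr : ∀ l, p l r = 0) (hp0 : ∀ i, i ≠ r → 0 ≤ p 0 i)
    (hpinit : ∀ i, i ≠ r → p 0 i ≤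
      if (B i).card = 1 then 4 * β else if (B i).card = 2 then 3 * β else 5 * β / 3)
    (hprec : ∀ l i, i ≠ r → p (l + 1) i = (∑ j ∈ B i, (c i j + p l j)⁻¹)⁻¹)
    (l : ℕ) (i : V) : 0 ≤ p l i ∧ p l i ≤ 4 * β := by
  set K : V → ℝ := fun i =>
    if (B i).card = 1 then 4 * β else if (B i).card = 2 then 3 * β else 5 * β / 3 with hK
  have hK4 : ∀ i, K i ≤ 4 * β := by intro i; simp only [hK]; split_ifs <;> linarith
  have hK0 : ∀ i, 0 ≤ K i := by intro i; simp only [hK]; split_ifs <;> linarith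
  have hK3 : ∀ i, (B i).card ≠ 1 → K i ≤ 3 * β := by
    intro i hi; simp only [hK, if_neg hi]; split_ifs <;> linarith
  suffices H : ∀ l i, 0 ≤ p l i ∧ p l i ≤ K i from ⟨(H l i).1, (H l i).2.trans (hK4 i)⟩
  intro l
  induction l with
  | zero =>
    intro i
    by_cases hi : i = r
    · subst hi; rw [hpr]; exact ⟨le_rfl, hK0 _⟩
    · exact ⟨hp0 i hi, hpinit i hi⟩
  | succ l ih =>
    intro i
    by_cases hi : i = r
    · subst hi; rw [hpr]; exact ⟨le_rfl, hK0 _⟩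
    have hpos : ∀ j ∈ B i, 0 < c i j + p l j := fun j hj =>
      add_pos_of_pos_of_nonneg (hc0 i hi j hj) (ih j).1
    have hle : ∀ j ∈ B i, c i j + p l j ≤ 5 * β := fun j hj => by
      have := hcβ i hi j hj; have := (ih j).2; have := hK4 j; linarith
    rw [hprec l i hi]
    refine ⟨inv_nonneg.mpr (Finset.sum_nonneg fun j hj => inv_nonneg.mpr (hpos j hj).le), ?_⟩
    have hcard : 0 < (B i).card := Finset.card_pos.mpr (hne i hi)
    by_cases h1 : (B i).card = 1
    · obtain ⟨j, hj⟩ := Finset.card_eq_one.mp h1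
      have hji : j ∈ B i := by simp [hj]
      have hpj : p l j ≤ 3 * β := by
        by_cases hjr : j = r
        · rw [hjr, hpr]; positivity
        · exact (ih j).2.trans (hK3 j (card_ne_one_of_reachable B r hsym h hi hjr hj))
      have := hcβ i hi j hji
      simp only [hK, if_pos h1]
      rw [hj, Finset.sum_singleton, inv_inv]
      linarith
    · by_cases h2 : (B i).card = 2
      · have := inv_sum_inv_le (B i) _ (m := 2) (by norm_num) h2.ge hpos hle
        simp only [hK, if_neg h1, if_pos h2]
        push_cast at this
        linarith
      · have := inv_sum_inv_le (B i) _ (m := 3) (by norm_num) (by omega) hpos hle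
        simp only [hK, if_neg h1, if_neg h2]
        exact_mod_cast this

/-- The scalar error recursion converges to zero. -/
lemma scalar_error_tendsto_zero [Fintype V] (B : V → Finset V) (r : V)
    (hsym : ∀ i j, j ∈ B i ↔ i ∈ B j) (hne : ∀ i, i ≠ r → (B i).Nonempty)
    (h : ∀ i, Relation.ReflTransGen (fun a b => b ∈ B a) i r)
    (c : V → V → ℝ) {α : ℝ} (hα : 0 < α)
    (hc0 : ∀ i, i ≠ r → ∀ j ∈ B i, 0 < c i j)
    (p : ℕ → V → ℝ) (hpr : ∀ l, p l r = 0)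
    (hpinit : ∀ i, i ≠ r → p 0 i =
      if (B i).card = 1 then 4 * α else if (B i).card = 2 then 3 * α else 5 * α / 3)
    (hprec : ∀ l i, i ≠ r → p (l + 1) i = (∑ j ∈ B i, (c i j + p l j)⁻¹)⁻¹)
    (e : ℕ → V → ℂ) (her : ∀ l, e l r = 0)
    (he : ∀ l i, i ≠ r →
      e (l + 1) i = (p (l + 1) i : ℂ) * ∑ j ∈ B i, ((c i j + p l j : ℝ) : ℂ)⁻¹ * e l j) (i : V) :
    Tendsto (fun l => e l i) atTop (𝓝 0) := by
  classical
  set β : ℝ := α + ∑ i, ∑ j, |c i j| with hβdef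
  have hcβ : ∀ i j, |c i j| + α ≤ β := by
    intro i j
    have h1 : |c i j| ≤ ∑ j, |c i j| :=
      Finset.single_le_sum (f := fun j => |c i j|) (fun _ _ => abs_nonneg _) (Finset.mem_univ j)
    have h2 : ∑ j, |c i j| ≤ ∑ i, ∑ j, |c i j| :=
      Finset.single_le_sum (f := fun i => ∑ j, |c i j|)
        (fun _ _ => Finset.sum_nonneg fun _ _ => abs_nonneg _) (Finset.mem_univ i)
    linarith
  have hαβ : α ≤ β := by have := hcβ r r; have := abs_nonneg (c r r); linarith
  have hβ : 0 < β := hα.trans_le hαβ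
  have hpb := scalar_covariance_bounds B r hsym hne h c hβ hc0
    (fun i _ j _ => by have := hcβ i j; have := le_abs_self (c i j); linarith) p hpr
    (fun i hi => by rw [hpinit i hi]; split_ifs <;> positivity)
    (fun i hi => by rw [hpinit i hi]; split_ifs <;> linarith) hprec
  have hpos : ∀ l i, i ≠ r → ∀ j ∈ B i, 0 < c i j + p l j := fun l i hi j hj =>
    add_pos_of_pos_of_nonneg (hc0 i hi j hj) (hpb l j).1
  have hspos : ∀ l i, i ≠ r → 0 < ∑ j ∈ B i, (c i j + p l j)⁻¹ := fun l i hi =>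
    Finset.sum_pos (fun j hj => inv_pos.mpr (hpos l i hi j hj)) (hne i hi)
  set G : ℝ := 1 + ∑ i, ∑ j, |(c i j)⁻¹| with hG
  have hG0 : 0 < G := by positivity
  have hsG : ∀ l i, i ≠ r → ∑ j ∈ B i, (c i j + p l j)⁻¹ ≤ G := by
    intro l i hi
    calc _ ≤ ∑ j ∈ B i, |(c i j)⁻¹| := Finset.sum_le_sum fun j hj =>
          (inv_anti₀ (hc0 i hi j hj) (by have := (hpb l j).1; linarith)).trans (le_abs_self _)
      _ ≤ ∑ j, |(c i j)⁻¹| := Finset.sum_le_univ_sum_of_nonneg fun _ => abs_nonneg _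
      _ ≤ ∑ i, ∑ j, |(c i j)⁻¹| :=
          Finset.single_le_sum (f := fun i => ∑ j, |(c i j)⁻¹|)
            (fun _ _ => Finset.sum_nonneg fun _ _ => abs_nonneg _) (Finset.mem_univ i)
      _ ≤ G := by linarith
  refine tendsto_zero_of_averaging B r h (δ := G⁻¹ * (5 * β)⁻¹) (by positivity)
    (fun l i j => p (l + 1) i * (c i j + p l j)⁻¹) ?_ ?_ e her ?_ i
  · intro l i hi j hj
    rw [hprec l i hi]
    refine mul_le_mul (inv_anti₀ (hspos l i hi) (hsG l i hi))
      (inv_anti₀ (hpos l i hi j hj) ?_) (by positivity) (inv_nonneg.mpr (hspos l i hi).le)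
    have := (hpb l j).2; have := hcβ i j; have := le_abs_self (c i j)
    linarith
  · intro l i hi
    rw [← Finset.mul_sum, hprec l i hi]
    exact inv_mul_cancel₀ (hspos l i hi).ne'
  · intro l i hi
    rw [he l i hi, Finset.mul_sum]
    refine Finset.sum_congr rfl fun j _ => ?_
    push_cast
    ring

end Graph

section Mean

variable {Ω : Type*} [MeasurableSpace Ω] {ν : Measure Ω} {d : Type*}

/-- `X` is entrywise integrable with expectation `m`. -/
def HasMean (ν : Measure Ω) (X : Ω → d → ℂ) (m : d → ℂ) : Prop :=
  ∀ a, Integrable (fun ω => X ω a) ν ∧ ∫ ω, X ω a ∂ν = m a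

lemma HasMean.const [IsProbabilityMeasure ν] (v : d → ℂ) : HasMean ν (fun _ => v) v :=
  fun a => ⟨integrable_const _, by simp⟩

lemma HasMean.add {X Y : Ω → d → ℂ} {m m' : d → ℂ} (hX : HasMean ν X m) (hY : HasMean ν Y m') :
    HasMean ν (fun ω => X ω + Y ω) (m + m') := fun a =>
  ⟨(hX a).1.add (hY a).1, by
    simp only [Pi.add_apply]
    rw [integral_add (hX a).1 (hY a).1, (hX a).2, (hY a).2]⟩

lemma HasMean.sum {ι : Type*} (s : Finset ι) {X : ι → Ω → d → ℂ} {m : ι → d → ℂ}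
    (h : ∀ j ∈ s, HasMean ν (X j) (m j)) :
    HasMean ν (fun ω => ∑ j ∈ s, X j ω) (∑ j ∈ s, m j) := fun a => by
  simp only [Finset.sum_apply]
  refine ⟨integrable_finsetSum s fun j hj => (h j hj a).1, ?_⟩
  rw [integral_finsetSum s fun j hj => (h j hj a).1]
  exact Finset.sum_congr rfl fun j hj => (h j hj a).2

lemma HasMean.mulVec [Fintype d] (M : Matrix d d ℂ) {X : Ω → d → ℂ} {m : d → ℂ}
    (h : HasMean ν X m) : HasMean ν (fun ω => M.mulVec (X ω)) (M.mulVec m) := fun a => by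
  simp only [Matrix.mulVec, dotProduct]
  refine ⟨integrable_finsetSum _ fun j _ => (h j).1.const_mul _, ?_⟩
  rw [integral_finsetSum _ fun j _ => (h j).1.const_mul _]
  exact Finset.sum_congr rfl fun j _ => by rw [integral_const_mul, (h j).2]

end Mean

section UnitaryDiagonal

variable {d : Type*} [Fintype d] [DecidableEq d] {U : Matrix d d ℂ}

/-- The matrix with eigenvalues `v` in the orthonormal basis formed by the columns of `U`. -/
def conjDiagonal (U : Matrix d d ℂ) (v : d → ℂ) : Matrix d d ℂ := U * Matrix.diagonal v * Uᴴ

lemma conjDiagonal_add (v w : d → ℂ) :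
    conjDiagonal U v + conjDiagonal U w = conjDiagonal U (v + w) := by
  simp only [conjDiagonal, ← Matrix.add_mul, ← Matrix.mul_add, Matrix.diagonal_add]
  rfl

lemma conjDiagonal_sum {ι : Type*} (s : Finset ι) (v : ι → d → ℂ) :
    ∑ j ∈ s, conjDiagonal U (v j) = conjDiagonal U (∑ j ∈ s, v j) := by
  classical
  induction s using Finset.induction_on with
  | empty => simp [conjDiagonal]
  | insert a s ha ih => rw [Finset.sum_insert ha, Finset.sum_insert ha, ih, conjDiagonal_add]

lemma conjDiagonal_mul (hU : Uᴴ * U = 1) (v w : d → ℂ) :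
    conjDiagonal U v * conjDiagonal U w = conjDiagonal U (v * w) := by
  have : conjDiagonal U v * conjDiagonal U w
      = U * Matrix.diagonal v * (Uᴴ * U) * Matrix.diagonal w * Uᴴ := by
    simp only [conjDiagonal, Matrix.mul_assoc]
  rw [this, hU, Matrix.mul_one, conjDiagonal, Matrix.mul_assoc U, Matrix.diagonal_mul_diagonal]
  rfl

lemma conjDiagonal_inv (hU : Uᴴ * U = 1) (hU' : U * Uᴴ = 1) {v : d → ℂ} (hv : ∀ a, v a ≠ 0) :
    (conjDiagonal U v)⁻¹ = conjDiagonal U v⁻¹ := by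
  refine Matrix.inv_eq_right_inv ?_
  rw [conjDiagonal_mul hU, show v * v⁻¹ = 1 from funext fun a => mul_inv_cancel₀ (hv a),
    conjDiagonal, show (Matrix.diagonal (1 : d → ℂ)) = 1 from Matrix.diagonal_one,
    Matrix.mul_one, hU']

lemma conjTranspose_mulVec_conjDiagonal_mulVec (hU : Uᴴ * U = 1) (v x : d → ℂ) :
    Uᴴ.mulVec ((conjDiagonal U v).mulVec x) = v * Uᴴ.mulVec x := by
  rw [Matrix.mulVec_mulVec, conjDiagonal, ← Matrix.mul_assoc, ← Matrix.mul_assoc, hU,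
    Matrix.one_mul, ← Matrix.mulVec_mulVec]
  ext a
  simp [Matrix.mulVec_diagonal]

end UnitaryDiagonal

/-- The scalar covariance recursion started at `p₀`, with value `0` at node `0`. -/
noncomputable def scalarCovariance {V : Type*} [DecidableEq V] (B : V → Finset V) (r : V)
    (c : V → V → ℝ) (p₀ : V → ℝ) : ℕ → V → ℝ
  | 0, i => if i = r then 0 else p₀ i
  | l + 1, i =>
    if i = r then 0 else (∑ j ∈ B i, (c i j + scalarCovariance B r c p₀ l j)⁻¹)⁻¹

/-- Mean convergence of the gSPAWN localization mean recursion: if some unitary `U`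
simultaneously diagonalizes all noise covariances `C_{ij}` (with positive real diagonal
entries), then the expected location estimates converge to the true node locations. -/
theorem stmt_17 {n : ℕ}
    (B : Fin (n + 1) → Finset (Fin (n + 1)))
    (hsym : ∀ i j : Fin (n + 1), j ∈ B i ↔ i ∈ B j)
    (hne : ∀ i : Fin (n + 1), i ≠ 0 → (B i).Nonempty)
    (hconn : ∀ i j : Fin (n + 1), Relation.ReflTransGen (fun a b => b ∈ B a) i j)
    -- each component of the graph with node 0 removed is strongly connected
    (hscc : ∀ i j : Fin (n + 1),
      Relation.ReflTransGen (fun a b => a ≠ 0 ∧ b ≠ 0 ∧ b ∈ B a) i j →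
      Relation.ReflTransGen (fun a b => a ≠ 0 ∧ b ≠ 0 ∧ b ∈ B a) j i)
    (C : Fin (n + 1) → Fin (n + 1) → Matrix (Fin 2) (Fin 2) ℂ)
    (hC : ∀ i : Fin (n + 1), i ≠ 0 → ∀ j ∈ B i, (C i j).PosDef)
    (α : ℝ) (hαpos : 0 < α)
    (hαC : ∀ i : Fin (n + 1), i ≠ 0 → ∀ j ∈ B i, lamMax (C i j) ≤ α)
    -- a unitary U with Uᴴ C_{ij} U diagonal with positive real diagonal entries
    (U : Matrix (Fin 2) (Fin 2) ℂ) (hU1 : Uᴴ * U = 1) (hU2 : U * Uᴴ = 1)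
    (hUC : ∀ i : Fin (n + 1), i ≠ 0 → ∀ j ∈ B i, ∃ D : Fin 2 → ℝ, (∀ a, 0 < D a) ∧
      Uᴴ * C i j * U = Matrix.diagonal (fun a => (D a : ℂ)))
    -- the gSPAWN localization covariance recursion with α₀ = 0
    (P : ℕ → Fin (n + 1) → Matrix (Fin 2) (Fin 2) ℂ)
    (hP0 : ∀ l, P l 0 = 0)
    (hPinit : ∀ i : Fin (n + 1), i ≠ 0 → P 0 i =
      (if (B i).card = 1 then ((4 * α : ℝ) : ℂ)
       else if (B i).card = 2 then ((3 * α : ℝ) : ℂ)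
       else ((5 * α / 3 : ℝ) : ℂ)) • 1)
    (hPrec : ∀ l, ∀ i : Fin (n + 1), i ≠ 0 →
      P (l + 1) i = (∑ j ∈ B i, (C i j + P l j)⁻¹)⁻¹)
    -- true locations, zero-mean integrable noise, and measurements d_{ij} = s_i - s_j + ω_{ij}
    {Ω : Type*} [MeasurableSpace Ω] (μpr : Measure Ω) [IsProbabilityMeasure μpr]
    (s : Fin (n + 1) → (Fin 2 → ℂ))
    (w : Fin (n + 1) → Fin (n + 1) → Ω → (Fin 2 → ℂ))
    (hwint : ∀ i : Fin (n + 1), i ≠ 0 → ∀ j ∈ B i, ∀ a,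
      Integrable (fun ω => w i j ω a) μpr)
    (hwmean : ∀ i : Fin (n + 1), i ≠ 0 → ∀ j ∈ B i, ∀ a, ∫ ω, w i j ω a ∂μpr = 0)
    -- the gSPAWN mean recursion
    (μv : ℕ → Fin (n + 1) → Ω → (Fin 2 → ℂ))
    (hμ0 : ∀ l ω, μv l 0 ω = s 0)
    (hμinit : ∀ i : Fin (n + 1), i ≠ 0 → ∀ ω, μv 0 i ω = 0)
    (hμrec : ∀ l, ∀ i : Fin (n + 1), i ≠ 0 → ∀ ω,
      μv (l + 1) i ω = (P (l + 1) i).mulVec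
        (∑ j ∈ B i, ((C i j + P l j)⁻¹).mulVec (μv l j ω + (s i - s j + w i j ω)))) :
    ∀ i : Fin (n + 1), i ≠ 0 → ∀ a,
      Tendsto (fun l => ∫ ω, μv l i ω a ∂μpr) atTop (𝓝 (s i a)) := by
  classical
  have hc : ∀ i j : Fin (n + 1), ∃ D : Fin 2 → ℝ, i ≠ 0 → j ∈ B i →
      (∀ a, 0 < D a) ∧ C i j = conjDiagonal U (fun a => (D a : ℂ)) := by
    intro i j
    by_cases hij : i ≠ 0 ∧ j ∈ B i
    · obtain ⟨D, hD, hCD⟩ := hUC i hij.1 j hij.2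
      refine ⟨D, fun _ _ => ⟨hD, ?_⟩⟩
      rw [conjDiagonal, ← hCD]
      calc C i j = (U * Uᴴ) * C i j * (U * Uᴴ) := by rw [hU2, Matrix.one_mul, Matrix.mul_one]
        _ = _ := by simp only [Matrix.mul_assoc]
    · exact ⟨0, fun hi hj => absurd ⟨hi, hj⟩ hij⟩
  choose D hD using hc
  have hreach : ∀ i, Relation.ReflTransGen (fun a b => b ∈ B a) i 0 := fun i => hconn i 0
  set κ : Fin (n + 1) → ℝ := fun i =>
    if (B i).card = 1 then 4 * α else if (B i).card = 2 then 3 * α else 5 * α / 3 with hκ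
  have hκ0 : ∀ i, 0 < κ i := by intro i; simp only [hκ]; split_ifs <;> positivity
  set p : Fin 2 → ℕ → Fin (n + 1) → ℝ := fun a =>
    scalarCovariance B 0 (fun i j => D i j a) κ with hp
  have hpr : ∀ a l, p a l 0 = 0 := by intro a l; cases l <;> simp [hp, scalarCovariance]
  have hpinit : ∀ a i, i ≠ 0 → p a 0 i = κ i := by
    intro a i hi; simp [hp, scalarCovariance, hi]
  have hprec : ∀ a l i, i ≠ 0 → p a (l + 1) i = (∑ j ∈ B i, (D i j a + p a l j)⁻¹)⁻¹ := by
    intro a l i hi; simp [hp, scalarCovariance, hi]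
  have hDpos : ∀ a i, i ≠ 0 → ∀ j ∈ B i, 0 < D i j a := fun a i hi j hj => (hD i j hi hj).1 a
  have hpnn : ∀ a l i, 0 ≤ p a l i := by
    intro a l
    induction l with
    | zero =>
      intro i
      by_cases hi : i = 0
      · rw [hi, hpr]
      · rw [hpinit a i hi]; exact (hκ0 i).le
    | succ l ih =>
      intro i
      by_cases hi : i = 0
      · rw [hi, hpr]
      · rw [hprec a l i hi]
        exact inv_nonneg.mpr (Finset.sum_nonneg fun j hj =>
          inv_nonneg.mpr (add_nonneg (hDpos a i hi j hj).le (ih j)))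
  have hpos : ∀ a l i, i ≠ 0 → ∀ j ∈ B i, 0 < D i j a + p a l j := fun a l i hi j hj =>
    add_pos_of_pos_of_nonneg (hDpos a i hi j hj) (hpnn a l j)
  have hspos : ∀ a l i, i ≠ 0 → 0 < ∑ j ∈ B i, (D i j a + p a l j)⁻¹ := fun a l i hi =>
    Finset.sum_pos (fun j hj => inv_pos.mpr (hpos a l i hi j hj)) (hne i hi)
  have hinv : ∀ l, (∀ j, P l j = conjDiagonal U fun a => (p a l j : ℂ)) → ∀ i, i ≠ 0 → ∀ j ∈ B i,
      (C i j + P l j)⁻¹ = conjDiagonal U fun a => ((D i j a + p a l j : ℝ) : ℂ)⁻¹ := by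
    intro l hl i hi j hj
    rw [hl j, (hD i j hi hj).2, conjDiagonal_add, conjDiagonal_inv hU1 hU2]
    · congr 1
      ext a
      simp
    · intro a
      have := (hpos a l i hi j hj).ne'
      simp only [Pi.add_apply]
      exact_mod_cast this
  have hP : ∀ l i, P l i = conjDiagonal U fun a => (p a l i : ℂ) := by
    intro l
    induction l with
    | zero =>
      intro i
      by_cases hi : i = 0
      · subst hi
        simp only [hP0, hpr, conjDiagonal]
        simp
      · simp only [hPinit i hi, hpinit _ i hi]
        rw [conjDiagonal, ← Matrix.smul_one_eq_diagonal, Matrix.mul_smul, Matrix.smul_mul,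
          Matrix.mul_one, hU2]
        congr 1
        simp only [hκ]
        split_ifs <;> rfl
    | succ l ih =>
      intro i
      by_cases hi : i = 0
      · subst hi
        simp only [hP0, hpr, conjDiagonal]
        simp
      · rw [hPrec l i hi, Finset.sum_congr rfl (hinv l ih i hi), conjDiagonal_sum,
          conjDiagonal_inv hU1 hU2]
        · congr 1
          ext a
          simp [hprec a l i hi]
        · intro a
          have := (hspos a l i hi).ne'
          simp only [Finset.sum_apply]
          exact_mod_cast this
  have hPsum : ∀ l i, i ≠ 0 → P (l + 1) i * ∑ j ∈ B i, (C i j + P l j)⁻¹ = 1 := by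
    intro l i hi
    rw [Finset.sum_congr rfl (hinv l (hP l) i hi), conjDiagonal_sum, hP, conjDiagonal_mul hU1,
      ← hU2, conjDiagonal]
    congr 1
    convert Matrix.mul_one U
    rw [← Matrix.diagonal_one]
    congr 1
    ext a
    have := inv_mul_cancel₀ (hspos a l i hi).ne'
    rw [← hprec a l i hi] at this
    simp only [Pi.mul_apply, Finset.sum_apply]
    exact_mod_cast this
  set m : ℕ → Fin (n + 1) → Fin 2 → ℂ := fun l i a => ∫ ω, μv l i ω a ∂μpr with hm
  have hstep : ∀ l, (∀ i, HasMean μpr (μv l i) (m l i)) → ∀ i, i ≠ 0 →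
      HasMean μpr (μv (l + 1) i) ((P (l + 1) i).mulVec
        (∑ j ∈ B i, ((C i j + P l j)⁻¹).mulVec (m l j + (s i - s j + 0)))) := by
    intro l hl i hi
    rw [show μv (l + 1) i = _ from funext (hμrec l i hi)]
    refine HasMean.mulVec _ (HasMean.sum _ fun j hj => HasMean.mulVec _ ((hl j).add
      ((HasMean.const _).add fun a => ⟨hwint i hi j hj a, hwmean i hi j hj a⟩)))
  have hmean : ∀ l i, HasMean μpr (μv l i) (m l i) := by
    intro l
    induction l with
    | zero =>
      intro i a
      refine ⟨?_, rfl⟩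
      by_cases hi : i = 0
      · subst hi; simp only [hμ0]; exact integrable_const _
      · simp only [hμinit i hi]; exact integrable_const _
    | succ l ih =>
      intro i a
      refine ⟨?_, rfl⟩
      by_cases hi : i = 0
      · subst hi; simp only [hμ0]; exact integrable_const _
      · exact (hstep l ih i hi a).1
  have hmrec : ∀ l i, i ≠ 0 → m (l + 1) i - s i = (P (l + 1) i).mulVec
      (∑ j ∈ B i, ((C i j + P l j)⁻¹).mulVec (m l j - s j)) := by
    intro l i hi
    have h1 : m (l + 1) i = _ := funext fun a => (hstep l (hmean l) i hi a).2
    have h2 : s i = (P (l + 1) i).mulVec (∑ j ∈ B i, ((C i j + P l j)⁻¹).mulVec (s i)) := by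
      rw [← Matrix.sum_mulVec, Matrix.mulVec_mulVec, hPsum l i hi, Matrix.one_mulVec]
    rw [h1]
    nth_rewrite 2 [h2]
    rw [← Matrix.mulVec_sub, ← Finset.sum_sub_distrib]
    congr 1
    refine Finset.sum_congr rfl fun j _ => ?_
    rw [← Matrix.mulVec_sub]
    congr 1
    abel
  have hm0 : ∀ l, m l 0 - s 0 = 0 := by
    intro l
    ext a
    simp [hm, hμ0]
  have hlim : ∀ b i, Tendsto (fun l => Uᴴ.mulVec (m l i - s i) b) atTop (𝓝 0) := by
    intro b i
    refine scalar_error_tendsto_zero B 0 hsym hne hreach (fun i j => D i j b) hαpos (hDpos b)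
      (p b) (hpr b) (hpinit b) (hprec b) (fun l i => Uᴴ.mulVec (m l i - s i) b) ?_ ?_ i
    · intro l; simp [hm0]
    · intro l i hi
      simp only [hmrec l i hi, hP (l + 1) i]
      rw [conjTranspose_mulVec_conjDiagonal_mulVec hU1, Pi.mul_apply, Matrix.mulVec_sum,
        Finset.sum_apply]
      congr 1
      refine Finset.sum_congr rfl fun j hj => ?_
      rw [hinv l (hP l) i hi j hj, conjTranspose_mulVec_conjDiagonal_mulVec hU1]
      rfl
  intro i _ a
  have hrepr : ∀ l, m l i a = ∑ b, U a b * Uᴴ.mulVec (m l i - s i) b + s i a := by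
    intro l
    have : U.mulVec (Uᴴ.mulVec (m l i - s i)) = m l i - s i := by
      rw [Matrix.mulVec_mulVec, hU2, Matrix.one_mulVec]
    have := congrFun this a
    rw [Matrix.mulVec, dotProduct] at this
    rw [this]
    simp
  change Tendsto (fun l => m l i a) atTop (𝓝 (s i a))
  simp only [hrepr]
  simpa using (tendsto_finsetSum Finset.univ
    fun b _ => (hlim b i).const_mul (U a b)).add_const (s i a)
end
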